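/- Under the Volterra system setup, for every t ∈ [0,T], |z(t) − z̃(t)| ≤ L C²_ε ‖J^ε_0 z̃ − z̃‖_∞ · E_{α₂−1}(L C¹_ε T^{α₂−1}), where C¹_ε := (Γ(α₂−1)/Γ(α₂−1+ε)) T^ε + (Γ(α₂−1)/Γ(α₂)) T and C²_ε := T^{α₂−ε}/Γ(α₂−ε+1) + T^{α₂−1}/Γ(α₂). -/

import Mathlib

/-- Riemann–Liouville fractional integral of order `α` with base point `a`. -/
noncomputable def rlInt (a α : ℝ) (y : ℝ → ℝ) (t : ℝ) : ℝ :=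
  (1 / Real.Gamma α) * ∫ τ in a..t, (t - τ) ^ (α - 1) * y τ

/-- The Mittag-Leffler function `E_α(x) = ∑_{n=0}^∞ x^n / Γ(nα + 1)`. -/
noncomputable def mittagLeffler (α x : ℝ) : ℝ :=
  ∑' n : ℕ, x ^ n / Real.Gamma (n * α + 1)

section RiemannLiouville

open MeasureTheory Set Filter Topology

theorem integral_sub_rpow_mul_rpow {a b c : ℝ} (ha : 0 < a) (hb : 0 < b) (hc : 0 < c) :
    ∫ x in (0:ℝ)..c, (c - x) ^ (a - 1) * x ^ (b - 1) =
      c ^ (a + b - 1) * (Real.Gamma a * Real.Gamma b / Real.Gamma (a + b)) := by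
  have h := Complex.betaIntegral_scaled (b : ℂ) (a : ℂ) hc
  rw [Complex.betaIntegral_eq_Gamma_mul_div _ _ (by simpa) (by simpa)] at h
  have h1 : ∫ x in (0:ℝ)..c, (x : ℂ) ^ ((b : ℂ) - 1) * ((c : ℂ) - x) ^ ((a : ℂ) - 1) =
      ((∫ x in (0:ℝ)..c, (c - x) ^ (a - 1) * x ^ (b - 1) : ℝ) : ℂ) := by
    rw [← intervalIntegral.integral_ofReal]
    refine intervalIntegral.integral_congr fun x hx => ?_
    rw [uIcc_of_le hc.le] at hx
    rw [Complex.ofReal_mul, Complex.ofReal_cpow (sub_nonneg.2 hx.2), Complex.ofReal_cpow hx.1,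
      mul_comm]
    push_cast
    rfl
  rw [h1] at h
  apply Complex.ofReal_injective
  rw [h, add_comm a b, Complex.ofReal_mul, Complex.ofReal_cpow hc.le, Complex.ofReal_div,
    Complex.ofReal_mul, ← Complex.Gamma_ofReal, ← Complex.Gamma_ofReal, ← Complex.Gamma_ofReal,
    mul_comm (Complex.Gamma (a : ℂ))]
  push_cast
  rfl

theorem integral_sub_rpow_mul_sub_rpow {a b σ t : ℝ} (ha : 0 < a) (hb : 0 < b) (h : σ < t) :
    ∫ τ in σ..t, (t - τ) ^ (a - 1) * (τ - σ) ^ (b - 1) =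
      (t - σ) ^ (a + b - 1) * (Real.Gamma a * Real.Gamma b / Real.Gamma (a + b)) := by
  rw [← integral_sub_rpow_mul_rpow ha hb (sub_pos.2 h)]
  have := intervalIntegral.integral_comp_sub_right (a := σ) (b := t)
    (fun x => (t - σ - x) ^ (a - 1) * x ^ (b - 1)) σ
  simpa using this

theorem intervalIntegrable_sub_rpow_mul_sub_rpow {a b σ t : ℝ} (ha : 0 < a) (hb : 0 < b)
    (h : σ < t) :
    IntervalIntegrable (fun τ => (t - τ) ^ (a - 1) * (τ - σ) ^ (b - 1)) volume σ t := by
  refine intervalIntegral.intervalIntegrable_of_integral_ne_zero ?_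
  rw [integral_sub_rpow_mul_sub_rpow ha hb h]
  have := Real.Gamma_pos_of_pos ha
  have := Real.Gamma_pos_of_pos hb
  have := Real.Gamma_pos_of_pos (add_pos ha hb)
  have := Real.rpow_pos_of_pos (sub_pos.2 h) (a + b - 1)
  positivity

/-- Integrability of the integrand defining `rlInt 0 a y t`. -/
def RLIntegrable (a : ℝ) (y : ℝ → ℝ) (t : ℝ) : Prop :=
  IntervalIntegrable (fun τ => (t - τ) ^ (a - 1) * y τ) volume 0 t

theorem ContinuousOn.rlIntegrable {a t : ℝ} {y : ℝ → ℝ} (ha : 0 < a) (ht : 0 ≤ t)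
    (hy : ContinuousOn y (Icc 0 t)) : RLIntegrable a y t := by
  refine IntervalIntegrable.mul_continuousOn ?_ (by rwa [uIcc_of_le ht])
  have h := (intervalIntegral.intervalIntegrable_rpow' (a := 0) (b := t)
    (show -1 < a - 1 by linarith)).comp_sub_left t
  simpa using h.symm

theorem setIntegral_Ioo_indicator_Iio {t τ : ℝ} (hτ : τ ∈ Ioo 0 t) (g : ℝ → ℝ) :
    ∫ x in Ioo 0 t, (Iio τ).indicator g x = ∫ x in (0:ℝ)..τ, g x := by
  rw [setIntegral_indicator measurableSet_Iio, Ioo_inter_Iio, min_eq_right hτ.2.le,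
    intervalIntegral.integral_of_le hτ.1.le, integral_Ioc_eq_integral_Ioo]

theorem setIntegral_Ioo_indicator_Ioi {t σ : ℝ} (hσ : σ ∈ Ioo 0 t) (g : ℝ → ℝ) :
    ∫ x in Ioo 0 t, (Ioi σ).indicator g x = ∫ x in σ..t, g x := by
  rw [setIntegral_indicator measurableSet_Ioi, inter_comm, Ioi_inter_Ioo, max_eq_left hσ.1.le,
    intervalIntegral.integral_of_le hσ.2.le, integral_Ioc_eq_integral_Ioo]

theorem integrable_rl_kernel {a b t : ℝ} {y : ℝ → ℝ} (ha : 0 < a) (hb : 0 < b) (ht : 0 ≤ t)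
    (hy : ContinuousOn y (Icc 0 t)) :
    Integrable (Function.uncurry fun τ σ =>
        (Iio τ).indicator (fun σ => (t - τ) ^ (a - 1) * ((τ - σ) ^ (b - 1) * y σ)) σ)
      ((volume.restrict (Ioo 0 t)).prod (volume.restrict (Ioo 0 t))) := by
  have hmeas : AEStronglyMeasurable (Function.uncurry fun τ σ =>
        (Iio τ).indicator (fun σ => (t - τ) ^ (a - 1) * ((τ - σ) ^ (b - 1) * y σ)) σ)
      ((volume.restrict (Ioo 0 t)).prod (volume.restrict (Ioo 0 t))) := by
    have h1 : AEStronglyMeasurable y (volume.restrict (Ioo 0 t)) :=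
      (hy.mono Ioo_subset_Icc_self).aestronglyMeasurable measurableSet_Ioo
    have h2 : AEStronglyMeasurable
        (fun p : ℝ × ℝ => (t - p.1) ^ (a - 1) * ((p.1 - p.2) ^ (b - 1) * y p.2))
        ((volume.restrict (Ioo 0 t)).prod (volume.restrict (Ioo 0 t))) := by
      refine AEStronglyMeasurable.mul ?_ (AEStronglyMeasurable.mul ?_ h1.comp_snd)
      · exact Measurable.aestronglyMeasurable (by fun_prop)
      · exact Measurable.aestronglyMeasurable (by fun_prop)
    exact h2.indicator (measurableSet_lt measurable_snd measurable_fst)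
  have key : ∀ σ, (fun τ => (Iio τ).indicator
      (fun σ => (t - τ) ^ (a - 1) * ((τ - σ) ^ (b - 1) * y σ)) σ) =
      (Ioi σ).indicator (fun τ => ((t - τ) ^ (a - 1) * (τ - σ) ^ (b - 1)) * y σ) := by
    intro σ
    ext τ
    simp only [indicator, mem_Iio, mem_Ioi, mul_assoc]
  rw [integrable_prod_iff' hmeas]
  constructor
  · refine (ae_restrict_iff' measurableSet_Ioo).2 (ae_of_all _ fun σ hσ => ?_)
    simp only [Function.uncurry]
    rw [key σ, integrable_indicator_iff measurableSet_Ioi, IntegrableOn,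
      Measure.restrict_restrict measurableSet_Ioi, Ioi_inter_Ioo, sup_eq_left.2 hσ.1.le]
    have := (intervalIntegrable_sub_rpow_mul_sub_rpow ha hb hσ.2).mul_const (y σ)
    exact ((intervalIntegrable_iff_integrableOn_Ioo_of_le hσ.2.le).1 this)
  · have hint : IntegrableOn (fun σ => (t - σ) ^ (a + b - 1) * |y σ| *
        (Real.Gamma a * Real.Gamma b / Real.Gamma (a + b))) (Ioo 0 t) :=
      (intervalIntegrable_iff_integrableOn_Ioo_of_le ht).1
        ((hy.abs.rlIntegrable (add_pos ha hb) ht).mul_const _)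
    refine hint.congr ((ae_restrict_iff' measurableSet_Ioo).2 (ae_of_all _ fun σ hσ => ?_))
    have e : ∀ τ ∈ Ioo 0 t, ‖Function.uncurry (fun τ σ => (Iio τ).indicator
        (fun σ => (t - τ) ^ (a - 1) * ((τ - σ) ^ (b - 1) * y σ)) σ) (τ, σ)‖ =
        (Ioi σ).indicator (fun τ => ((t - τ) ^ (a - 1) * (τ - σ) ^ (b - 1)) * |y σ|) τ := by
      intro τ hτ
      simp only [Function.uncurry]
      rw [congrFun (key σ) τ]
      by_cases h : σ < τ
      · have h1 := Real.rpow_nonneg (sub_nonneg.2 hτ.2.le) (a - 1)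
        have h2 := Real.rpow_nonneg (sub_nonneg.2 h.le) (b - 1)
        simp [h, abs_of_nonneg h1, abs_of_nonneg h2]
      · simp [h]
    beta_reduce
    rw [setIntegral_congr_fun measurableSet_Ioo e, setIntegral_Ioo_indicator_Ioi hσ,
      intervalIntegral.integral_mul_const, integral_sub_rpow_mul_sub_rpow ha hb hσ.2]
    ring

theorem rlIntegrable_rlInt {a b t : ℝ} {y : ℝ → ℝ} (ha : 0 < a) (hb : 0 < b) (ht : 0 ≤ t)
    (hy : ContinuousOn y (Icc 0 t)) : RLIntegrable a (rlInt 0 b y) t := by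
  have h := ((integrable_rl_kernel ha hb ht hy).integral_prod_left).const_mul (1 / Real.Gamma b)
  refine (intervalIntegrable_iff_integrableOn_Ioo_of_le ht).2 ?_
  refine Integrable.congr h ((ae_restrict_iff' measurableSet_Ioo).2 (ae_of_all _ fun τ hτ => ?_))
  simp only [Function.uncurry]
  rw [setIntegral_Ioo_indicator_Iio hτ, intervalIntegral.integral_const_mul, rlInt]
  ring

/-- Semigroup property of the Riemann–Liouville integral. -/
theorem rlInt_rlInt {a b t : ℝ} {y : ℝ → ℝ} (ha : 0 < a) (hb : 0 < b) (ht : 0 ≤ t)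
    (hy : ContinuousOn y (Icc 0 t)) :
    rlInt 0 a (rlInt 0 b y) t = rlInt 0 (a + b) y t := by
  have h := integral_integral_swap (integrable_rl_kernel ha hb ht hy)
  have e1 : ∀ τ ∈ Ioo 0 t, (∫ σ in Ioo 0 t, (Iio τ).indicator
      (fun σ => (t - τ) ^ (a - 1) * ((τ - σ) ^ (b - 1) * y σ)) σ) =
      Real.Gamma b * ((t - τ) ^ (a - 1) * rlInt 0 b y τ) := by
    intro τ hτ
    have := (Real.Gamma_pos_of_pos hb).ne'
    rw [setIntegral_Ioo_indicator_Iio hτ, intervalIntegral.integral_const_mul, rlInt]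
    field_simp
  have e2 : ∀ σ ∈ Ioo 0 t, (∫ τ in Ioo 0 t, (Iio τ).indicator
      (fun σ => (t - τ) ^ (a - 1) * ((τ - σ) ^ (b - 1) * y σ)) σ) =
      (Real.Gamma a * Real.Gamma b / Real.Gamma (a + b)) * ((t - σ) ^ (a + b - 1) * y σ) := by
    intro σ hσ
    have : (fun τ => (Iio τ).indicator
        (fun σ => (t - τ) ^ (a - 1) * ((τ - σ) ^ (b - 1) * y σ)) σ) =
        (Ioi σ).indicator (fun τ => ((t - τ) ^ (a - 1) * (τ - σ) ^ (b - 1)) * y σ) := by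
      ext τ
      simp only [indicator, mem_Iio, mem_Ioi, mul_assoc]
    rw [this, setIntegral_Ioo_indicator_Ioi hσ, intervalIntegral.integral_mul_const,
      integral_sub_rpow_mul_sub_rpow ha hb hσ.2]
    ring
  rw [setIntegral_congr_fun measurableSet_Ioo e1, setIntegral_congr_fun measurableSet_Ioo e2,
    integral_const_mul, integral_const_mul] at h
  simp only [← integral_Ioc_eq_integral_Ioo, ← intervalIntegral.integral_of_le ht] at h
  have := (Real.Gamma_pos_of_pos ha).ne'
  have := (Real.Gamma_pos_of_pos hb).ne'
  have := (Real.Gamma_pos_of_pos (add_pos ha hb)).ne'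
  rw [rlInt, rlInt]
  field_simp at h ⊢
  linarith

theorem RLIntegrable.const_mul {a t : ℝ} {y : ℝ → ℝ} (h : RLIntegrable a y t) (c : ℝ) :
    RLIntegrable a (fun τ => c * y τ) t := by
  unfold RLIntegrable at *
  simpa only [mul_left_comm] using IntervalIntegrable.const_mul h c

theorem RLIntegrable.add {a t : ℝ} {y v : ℝ → ℝ} (hy : RLIntegrable a y t)
    (hv : RLIntegrable a v t) : RLIntegrable a (fun τ => y τ + v τ) t := by
  unfold RLIntegrable at *
  simpa only [mul_add] using IntervalIntegrable.add hy hv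

theorem rlInt_const_mul (a t c : ℝ) (y : ℝ → ℝ) :
    rlInt 0 a (fun τ => c * y τ) t = c * rlInt 0 a y t := by
  simp only [rlInt, mul_left_comm _ c, intervalIntegral.integral_const_mul]

theorem rlInt_add {a t : ℝ} {y v : ℝ → ℝ} (hy : RLIntegrable a y t) (hv : RLIntegrable a v t) :
    rlInt 0 a (fun τ => y τ + v τ) t = rlInt 0 a y t + rlInt 0 a v t := by
  simp only [rlInt, mul_add]
  rw [intervalIntegral.integral_add hy hv, mul_add]

theorem rlInt_sub {a t : ℝ} {y v : ℝ → ℝ} (hy : RLIntegrable a y t) (hv : RLIntegrable a v t) :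
    rlInt 0 a (fun τ => y τ - v τ) t = rlInt 0 a y t - rlInt 0 a v t := by
  simp only [rlInt, mul_sub]
  rw [intervalIntegral.integral_sub hy hv, mul_sub]

theorem rlInt_mono {a t : ℝ} {y v : ℝ → ℝ} (ha : 0 < a) (ht : 0 ≤ t) (hy : RLIntegrable a y t)
    (hv : RLIntegrable a v t) (h : ∀ τ ∈ Icc 0 t, y τ ≤ v τ) :
    rlInt 0 a y t ≤ rlInt 0 a v t := by
  have := Real.Gamma_pos_of_pos ha
  refine mul_le_mul_of_nonneg_left ?_ (by positivity)
  refine intervalIntegral.integral_mono_on ht hy hv fun τ hτ => ?_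
  exact mul_le_mul_of_nonneg_left (h τ hτ) (Real.rpow_nonneg (sub_nonneg.2 hτ.2) _)

theorem abs_rlInt_le {a t : ℝ} (y : ℝ → ℝ) (ha : 0 < a) (ht : 0 ≤ t) :
    |rlInt 0 a y t| ≤ rlInt 0 a (fun τ => |y τ|) t := by
  have := Real.Gamma_pos_of_pos ha
  rw [rlInt, abs_mul, abs_of_nonneg (by positivity : 0 ≤ 1 / Real.Gamma a)]
  refine mul_le_mul_of_nonneg_left ?_ (by positivity)
  refine (intervalIntegral.abs_integral_le_integral_abs ht).trans_eq ?_
  refine intervalIntegral.integral_congr fun τ hτ => ?_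
  rw [uIcc_of_le ht] at hτ
  simp only [abs_mul, abs_of_nonneg (Real.rpow_nonneg (sub_nonneg.2 hτ.2) (a - 1))]

theorem rlInt_rpow {a b t : ℝ} (ha : 0 < a) (hb : 0 ≤ b) (ht : 0 ≤ t) :
    rlInt 0 a (fun τ => τ ^ b / Real.Gamma (b + 1)) t = t ^ (a + b) / Real.Gamma (a + b + 1) := by
  rcases ht.eq_or_lt with rfl | ht
  · simp [rlInt, Real.zero_rpow (by positivity : a + b ≠ 0)]
  · have h := integral_sub_rpow_mul_rpow ha (by linarith : 0 < b + 1) ht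
    have := (Real.Gamma_pos_of_pos ha).ne'
    have := (Real.Gamma_pos_of_pos (by linarith : 0 < b + 1)).ne'
    simp only [rlInt, mul_div_assoc', intervalIntegral.integral_div]
    rw [add_sub_cancel_right] at h
    rw [h, ← add_assoc, add_sub_cancel_right]
    field_simp

theorem rlInt_one {a t : ℝ} (ha : 0 < a) (ht : 0 ≤ t) :
    rlInt 0 a (fun _ => 1) t = t ^ a / Real.Gamma (a + 1) := by
  simpa using rlInt_rpow ha le_rfl ht

theorem rlInt_le_rlInt_of_le {a c t T : ℝ} {u : ℝ → ℝ} (ha : 0 < a) (hac : a ≤ c) (ht : 0 ≤ t)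
    (htT : t ≤ T) (hu : ContinuousOn u (Icc 0 t)) (hu0 : ∀ τ ∈ Icc 0 t, 0 ≤ u τ) :
    rlInt 0 c u t ≤ Real.Gamma a / Real.Gamma c * T ^ (c - a) * rlInt 0 a u t := by
  have hc := ha.trans_le hac
  have h1 := Real.Gamma_pos_of_pos ha
  have h2 := Real.Gamma_pos_of_pos hc
  have h : ∫ τ in (0:ℝ)..t, (t - τ) ^ (c - 1) * u τ ≤
      ∫ τ in (0:ℝ)..t, T ^ (c - a) * ((t - τ) ^ (a - 1) * u τ) := by
    refine intervalIntegral.integral_mono_on_of_le_Ioo ht (hu.rlIntegrable hc ht)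
      (IntervalIntegrable.const_mul (hu.rlIntegrable ha ht) _) fun τ hτ => ?_
    have hp : 0 < t - τ := sub_pos.2 hτ.2
    rw [← mul_assoc, show c - 1 = (c - a) + (a - 1) by ring, Real.rpow_add hp]
    have := hu0 τ (Ioo_subset_Icc_self hτ)
    have : (t - τ) ^ (c - a) ≤ T ^ (c - a) :=
      Real.rpow_le_rpow hp.le (by linarith [hτ.1]) (by linarith)
    gcongr
  rw [intervalIntegral.integral_const_mul] at h
  rw [rlInt, rlInt]
  refine (mul_le_mul_of_nonneg_left h (by positivity : 0 ≤ 1 / Real.Gamma c)).trans_eq ?_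
  field_simp

theorem Gamma_le_rpow_mul_Gamma_add {x β : ℝ} (hx : 1 ≤ x) (hβ : 0 < β) (hβ1 : β < 1) :
    Real.Gamma x ≤ 2 * x ^ (-β) * Real.Gamma (x + β) := by
  have hx0 : 0 < x := by linarith
  have hG := Real.Gamma_pos_of_pos (by linarith : 0 < x + β)
  have h := Real.Gamma_mul_add_mul_le_rpow_Gamma_mul_rpow_Gamma (s := x + β) (t := x + β + 1)
    (by linarith) (by linarith) hβ (sub_pos.2 hβ1) (by ring)
  rw [show β * (x + β) + (1 - β) * (x + β + 1) = x + 1 by ring, Real.Gamma_add_one hx0.ne',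
    Real.Gamma_add_one (by linarith : x + β ≠ 0), Real.mul_rpow (by linarith) hG.le,
    mul_left_comm, ← Real.rpow_add hG, add_sub_cancel, Real.rpow_one] at h
  have h2 : (x + β) ^ (1 - β) ≤ 2 * x ^ (1 - β) := by
    calc (x + β) ^ (1 - β) ≤ (2 * x) ^ (1 - β) :=
          Real.rpow_le_rpow (by linarith) (by linarith) (by linarith)
      _ = 2 ^ (1 - β) * x ^ (1 - β) := Real.mul_rpow (by norm_num) hx0.le
      _ ≤ 2 ^ (1 : ℝ) * x ^ (1 - β) := by
          gcongr
          · norm_num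
          · linarith
      _ = 2 * x ^ (1 - β) := by rw [Real.rpow_one]
  have h3 : x * Real.Gamma x ≤ x * (2 * x ^ (-β) * Real.Gamma (x + β)) := by
    refine h.trans ((mul_le_mul_of_nonneg_right h2 hG.le).trans_eq ?_)
    rw [sub_eq_add_neg, Real.rpow_add hx0, Real.rpow_one]
    ring
  exact le_of_mul_le_mul_left h3 hx0

theorem summable_mittagLeffler {β : ℝ} (hβ : 0 < β) (hβ1 : β < 1) (x : ℝ) :
    Summable fun n : ℕ => x ^ n / Real.Gamma (n * β + 1) := by
  have hlim : Tendsto (fun n : ℕ => |x| * (2 * ((n : ℝ) * β + 1) ^ (-β))) atTop (𝓝 0) := by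
    have h1 : Tendsto (fun n : ℕ => (n : ℝ) * β + 1) atTop atTop :=
      tendsto_atTop_add_const_right _ _ (tendsto_natCast_atTop_atTop.atTop_mul_const hβ)
    simpa using (((tendsto_rpow_neg_atTop hβ).comp h1).const_mul 2).const_mul |x|
  refine summable_of_ratio_norm_eventually_le (r := 1 / 2) (by norm_num) ?_
  filter_upwards [hlim.eventually_le_const (by norm_num : (0 : ℝ) < 1 / 2)] with n hn
  have hn0 : 0 ≤ (n : ℝ) * β := by positivity
  have hG := Real.Gamma_pos_of_pos (by linarith : 0 < (n : ℝ) * β + 1)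
  have hG' := Real.Gamma_pos_of_pos (by linarith : 0 < (n : ℝ) * β + 1 + β)
  have h := Gamma_le_rpow_mul_Gamma_add (by linarith : 1 ≤ (n : ℝ) * β + 1) hβ hβ1
  have e : ((n + 1 : ℕ) : ℝ) * β + 1 = n * β + 1 + β := by push_cast; ring
  rw [e, norm_div, norm_div, norm_pow, norm_pow, Real.norm_eq_abs, Real.norm_of_nonneg hG.le,
    Real.norm_of_nonneg hG'.le, mul_div_assoc', div_le_div_iff₀ hG' hG, pow_succ]
  calc |x| ^ n * |x| * Real.Gamma (n * β + 1)
      ≤ |x| ^ n * |x| * (2 * ((n : ℝ) * β + 1) ^ (-β) * Real.Gamma (n * β + 1 + β)) := by gcongr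
    _ = |x| ^ n * (|x| * (2 * ((n : ℝ) * β + 1) ^ (-β))) * Real.Gamma (n * β + 1 + β) := by ring
    _ ≤ |x| ^ n * (1 / 2) * Real.Gamma (n * β + 1 + β) := by gcongr
    _ = 1 / 2 * |x| ^ n * Real.Gamma (n * β + 1 + β) := by ring

theorem rlIntegrable_rpow_div {a b t : ℝ} (ha : 0 < a) (hb : 0 ≤ b) (ht : 0 ≤ t) (c : ℝ) :
    RLIntegrable a (fun τ => τ ^ b / c) t :=
  ((Real.continuous_rpow_const hb).div_const c).continuousOn.rlIntegrable ha ht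

theorem rlInt_sum {a t : ℝ} {ι : Type*} (S : Finset ι) (y : ι → ℝ → ℝ)
    (hy : ∀ i ∈ S, RLIntegrable a (y i) t) :
    RLIntegrable a (fun τ => ∑ i ∈ S, y i τ) t ∧
      rlInt 0 a (fun τ => ∑ i ∈ S, y i τ) t = ∑ i ∈ S, rlInt 0 a (y i) t := by
  unfold RLIntegrable at *
  simp only [rlInt, Finset.mul_sum]
  refine ⟨?_, ?_⟩
  · simpa only [Finset.sum_fn] using IntervalIntegrable.sum S hy
  · rw [intervalIntegral.integral_finsetSum hy, Finset.mul_sum]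

/-- Fractional Grönwall inequality. -/
theorem le_mul_mittagLeffler_of_le_add_rlInt {β T A K : ℝ} {u : ℝ → ℝ} (hβ : 0 < β) (hβ1 : β < 1)
    (hA : 0 ≤ A) (hK : 0 ≤ K) (hu : ContinuousOn u (Icc 0 T))
    (h : ∀ t ∈ Icc 0 T, u t ≤ A + K * rlInt 0 β u t) :
    ∀ t ∈ Icc 0 T, u t ≤ A * mittagLeffler β (K * T ^ β) := by
  obtain ⟨U, hU⟩ := isCompact_Icc.exists_bound_of_continuousOn hu
  have hsucc : ∀ n : ℕ, β + (n : ℝ) * β = ((n + 1 : ℕ) : ℝ) * β := by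
    intro n; push_cast; ring
  have iter : ∀ n : ℕ, ∀ t ∈ Icc 0 T, u t ≤
      (∑ k ∈ Finset.range n, (A * K ^ k) * (t ^ ((k : ℝ) * β) / Real.Gamma (k * β + 1))) +
        (U * K ^ n) * (t ^ ((n : ℝ) * β) / Real.Gamma (n * β + 1)) := by
    intro n
    induction n with
    | zero =>
      intro t ht
      simpa using (le_abs_self _).trans (hU t ht)
    | succ n ih =>
      intro t ht
      have hI : ∀ k : ℕ, ∀ c : ℝ, RLIntegrable β
          (fun τ => c * (τ ^ ((k : ℝ) * β) / Real.Gamma (k * β + 1))) t := fun k c =>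
        (rlIntegrable_rpow_div hβ (by positivity) ht.1 _).const_mul c
      have hJ : ∀ k : ℕ, ∀ c : ℝ, rlInt 0 β
          (fun τ => c * (τ ^ ((k : ℝ) * β) / Real.Gamma (k * β + 1))) t =
          c * (t ^ (((k + 1 : ℕ) : ℝ) * β) / Real.Gamma ((k + 1 : ℕ) * β + 1)) := fun k c => by
        rw [rlInt_const_mul, rlInt_rpow hβ (by positivity) ht.1, hsucc]
      have hs := rlInt_sum (Finset.range n) (fun (k : ℕ) τ =>
        (A * K ^ k) * (τ ^ ((k : ℝ) * β) / Real.Gamma (k * β + 1))) (fun k _ => hI k _)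
      have hmono := rlInt_mono hβ ht.1
        ((hu.mono (Icc_subset_Icc_right ht.2)).rlIntegrable hβ ht.1) (hs.1.add (hI n (U * K ^ n)))
        (fun τ hτ => ih τ ⟨hτ.1, hτ.2.trans ht.2⟩)
      rw [rlInt_add hs.1 (hI n _), hs.2, hJ] at hmono
      simp only [hJ] at hmono
      refine (h t ht).trans ((add_le_add_right (mul_le_mul_of_nonneg_left hmono hK) A).trans_eq ?_)
      rw [Finset.sum_range_succ', mul_add, Finset.mul_sum]
      simp only [pow_succ]
      have : ∀ k ∈ Finset.range n, K * (A * K ^ k *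
          (t ^ (((k + 1 : ℕ) : ℝ) * β) / Real.Gamma ((k + 1 : ℕ) * β + 1))) =
          A * (K ^ k * K) * (t ^ (((k + 1 : ℕ) : ℝ) * β) / Real.Gamma ((k + 1 : ℕ) * β + 1)) :=
        fun k _ => by ring
      rw [Finset.sum_congr rfl this]
      simp
      ring
  intro t ht
  have hT : 0 ≤ T := ht.1.trans ht.2
  have hU0 : 0 ≤ U := (norm_nonneg _).trans (hU t ht)
  have hterm : ∀ n : ℕ, K ^ n * (t ^ ((n : ℝ) * β) / Real.Gamma (n * β + 1)) ≤
      (K * T ^ β) ^ n / Real.Gamma (n * β + 1) := by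
    intro n
    have hG := Real.Gamma_pos_of_pos (by positivity : 0 < (n : ℝ) * β + 1)
    have : t ^ ((n : ℝ) * β) ≤ (T ^ β) ^ n := by
      rw [← Real.rpow_natCast, ← Real.rpow_mul hT, mul_comm β]
      exact Real.rpow_le_rpow ht.1 ht.2 (by positivity)
    rw [mul_pow, mul_div_assoc]
    gcongr
  have hsum := summable_mittagLeffler hβ hβ1 (K * T ^ β)
  have hnn : ∀ n : ℕ, 0 ≤ (K * T ^ β) ^ n / Real.Gamma (n * β + 1) := fun n =>
    div_nonneg (by positivity) (Real.Gamma_pos_of_pos (by positivity)).le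
  have hbound : ∀ n : ℕ, u t ≤ A * mittagLeffler β (K * T ^ β) +
      U * ((K * T ^ β) ^ n / Real.Gamma (n * β + 1)) := by
    intro n
    refine (iter n t ht).trans (add_le_add ?_ ?_)
    · simp only [mul_assoc]
      rw [← Finset.mul_sum]
      refine mul_le_mul_of_nonneg_left ?_ hA
      exact (Finset.sum_le_sum fun k _ => hterm k).trans (hsum.sum_le_tsum _ fun k _ => hnn k)
    · rw [mul_assoc]
      exact mul_le_mul_of_nonneg_left (hterm n) hU0
  have hlim := (hsum.tendsto_atTop_zero.const_mul U).const_add (A * mittagLeffler β (K * T ^ β))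
  rw [mul_zero, add_zero] at hlim
  exact ge_of_tendsto' hlim hbound

/-- Stability of fractional Volterra solutions under replacing `J^ε z` by `z`. -/
theorem abs_sub_le_add_rlInt {T β ε s y₀ L M : ℝ} {f : ℝ → ℝ → ℝ → ℝ} {yh w z yt zt : ℝ → ℝ}
    (hβ : 0 < β) (hε : 0 < ε) (hε1 : ε < 1) (hL : 0 < L) (hM : 0 ≤ M)
    (hfc : Continuous fun p : ℝ × ℝ × ℝ => f p.1 p.2.1 p.2.2)
    (hlip : ∀ t ∈ Icc (0 : ℝ) T, ∀ x₁ x₂ y₁ y₂ : ℝ,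
      |f t x₁ y₁ - f t x₂ y₂| ≤ L * (|x₁ - x₂| + |y₁ - y₂|))
    (hyh : ContinuousOn yh (Icc 0 T)) (hw : ContinuousOn w (Icc 0 T))
    (hz : ContinuousOn z (Icc 0 T)) (hyt : ContinuousOn yt (Icc 0 T))
    (hzt : ContinuousOn zt (Icc 0 T))
    (heq1 : ∀ t ∈ Icc (0 : ℝ) T, yh t = y₀ + rlInt 0 (1 - ε) w t)
    (heq2 : ∀ t ∈ Icc (0 : ℝ) T, w t = rlInt 0 ε z t)
    (heq3 : ∀ t ∈ Icc (0 : ℝ) T, z t = s + rlInt 0 β (fun τ => f τ (yh τ) (w τ)) t)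
    (heq4 : ∀ t ∈ Icc (0 : ℝ) T, yt t = y₀ + rlInt 0 (1 - ε) zt t)
    (heq5 : ∀ t ∈ Icc (0 : ℝ) T, zt t = s + rlInt 0 β (fun τ => f τ (yt τ) (zt τ)) t)
    (hMb : ∀ t ∈ Icc (0 : ℝ) T, |rlInt 0 ε zt t - zt t| ≤ M) :
    ∀ t ∈ Icc (0 : ℝ) T, |z t - zt t| ≤
      L * (T ^ (β + (1 - ε)) / Real.Gamma (β + (1 - ε) + 1) + T ^ β / Real.Gamma (β + 1)) * M +
        L * (Real.Gamma β / Real.Gamma (β + ε) * T ^ ε +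
          Real.Gamma β / Real.Gamma (β + 1) * T) * rlInt 0 β (fun τ => |z τ - zt τ|) t := by
  set u : ℝ → ℝ := fun τ => |z τ - zt τ|
  have hu : ContinuousOn u (Icc 0 T) := (hz.sub hzt).abs
  have hε' : 0 < 1 - ε := sub_pos.2 hε1
  have restrict : ∀ {v : ℝ → ℝ} {t : ℝ}, ContinuousOn v (Icc 0 T) → t ∈ Icc 0 T →
      ContinuousOn v (Icc 0 t) := fun hv ht => hv.mono (Icc_subset_Icc_right ht.2)
  have hone : ∀ {a t : ℝ}, 0 < a → 0 ≤ t → RLIntegrable a (fun _ => 1) t := fun ha ht =>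
    continuousOn_const.rlIntegrable ha ht
  have hwz : ∀ t ∈ Icc 0 T, |w t - zt t| ≤ rlInt 0 ε u t + M * 1 := by
    intro t ht
    have e : w t - zt t = rlInt 0 ε (fun τ => z τ - zt τ) t + (rlInt 0 ε zt t - zt t) := by
      rw [heq2 t ht, rlInt_sub ((restrict hz ht).rlIntegrable hε ht.1)
        ((restrict hzt ht).rlIntegrable hε ht.1)]
      ring
    rw [e, mul_one]
    exact (abs_add_le _ _).trans (add_le_add (abs_rlInt_le _ hε ht.1) (hMb t ht))
  have hyy : ∀ t ∈ Icc 0 T, |yh t - yt t| ≤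
      rlInt 0 1 u t + M * (t ^ (1 - ε) / Real.Gamma (1 - ε + 1)) := by
    intro t ht
    have e : yh t - yt t = rlInt 0 (1 - ε) (fun τ => w τ - zt τ) t := by
      rw [heq1 t ht, heq4 t ht, rlInt_sub ((restrict hw ht).rlIntegrable hε' ht.1)
        ((restrict hzt ht).rlIntegrable hε' ht.1)]
      ring
    rw [e]
    have hI := rlIntegrable_rlInt hε' hε ht.1 (restrict hu ht)
    have hM1 := (hone hε' ht.1).const_mul M
    refine (abs_rlInt_le _ hε' ht.1).trans ((rlInt_mono hε' ht.1
      ((restrict (hw.sub hzt).abs ht).rlIntegrable hε' ht.1) (hI.add hM1)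
      (fun τ hτ => hwz τ ⟨hτ.1, hτ.2.trans ht.2⟩)).trans_eq ?_)
    rw [rlInt_add hI hM1, rlInt_const_mul, rlInt_one hε' ht.1,
      rlInt_rlInt hε' hε ht.1 (restrict hu ht), sub_add_cancel]
  have hcomp : ∀ {v v' : ℝ → ℝ}, ContinuousOn v (Icc 0 T) → ContinuousOn v' (Icc 0 T) →
      ContinuousOn (fun τ => f τ (v τ) (v' τ)) (Icc 0 T) := fun hv hv' =>
    hfc.comp_continuousOn (continuousOn_id.prodMk (hv.prodMk hv'))
  intro t ht
  have hF := hcomp hyh hw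
  have hG := hcomp hyt hzt
  have e : z t - zt t = rlInt 0 β (fun τ => f τ (yh τ) (w τ) - f τ (yt τ) (zt τ)) t := by
    rw [heq3 t ht, heq5 t ht, rlInt_sub ((restrict hF ht).rlIntegrable hβ ht.1)
      ((restrict hG ht).rlIntegrable hβ ht.1)]
    ring
  have hI1 := rlIntegrable_rlInt hβ one_pos ht.1 (restrict hu ht)
  have hI2 := (rlIntegrable_rpow_div hβ hε'.le ht.1 (Real.Gamma (1 - ε + 1))).const_mul M
  have hI3 := rlIntegrable_rlInt hβ hε ht.1 (restrict hu ht)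
  have hI4 := (hone hβ ht.1).const_mul M
  have hmain := (abs_rlInt_le _ hβ ht.1).trans (rlInt_mono hβ ht.1
    ((restrict (hF.sub hG).abs ht).rlIntegrable hβ ht.1)
    (((hI1.add hI2).add (hI3.add hI4)).const_mul L) (fun τ hτ => by
      have hτT : τ ∈ Icc 0 T := ⟨hτ.1, hτ.2.trans ht.2⟩
      exact (hlip τ hτT _ _ _ _).trans
        (mul_le_mul_of_nonneg_left (add_le_add (hyy τ hτT) (hwz τ hτT)) hL.le)))
  rw [rlInt_const_mul, rlInt_add (hI1.add hI2) (hI3.add hI4), rlInt_add hI1 hI2,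
    rlInt_add hI3 hI4, rlInt_const_mul, rlInt_const_mul, rlInt_rlInt hβ one_pos ht.1 (restrict hu ht),
    rlInt_rlInt hβ hε ht.1 (restrict hu ht), rlInt_one hβ ht.1, rlInt_rpow hβ hε'.le ht.1] at hmain
  have hu0 : ∀ τ ∈ Icc 0 t, 0 ≤ u τ := fun τ _ => abs_nonneg _
  have k1 := rlInt_le_rlInt_of_le hβ (by linarith : β ≤ β + 1) ht.1 ht.2 (restrict hu ht) hu0
  have k2 := rlInt_le_rlInt_of_le hβ (by linarith : β ≤ β + ε) ht.1 ht.2 (restrict hu ht) hu0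
  rw [add_sub_cancel_left, Real.rpow_one] at k1
  rw [add_sub_cancel_left] at k2
  have p1 : t ^ (β + (1 - ε)) / Real.Gamma (β + (1 - ε) + 1) ≤
      T ^ (β + (1 - ε)) / Real.Gamma (β + (1 - ε) + 1) :=
    div_le_div_of_nonneg_right (Real.rpow_le_rpow ht.1 ht.2 (by linarith))
      (Real.Gamma_pos_of_pos (by linarith)).le
  have p2 : t ^ β / Real.Gamma (β + 1) ≤ T ^ β / Real.Gamma (β + 1) :=
    div_le_div_of_nonneg_right (Real.rpow_le_rpow ht.1 ht.2 hβ.le)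
      (Real.Gamma_pos_of_pos (by linarith)).le
  rw [e]
  refine hmain.trans ((mul_le_mul_of_nonneg_left (add_le_add
    (add_le_add k1 (mul_le_mul_of_nonneg_left p1 hM))
    (add_le_add k2 (mul_le_mul_of_nonneg_left p2 hM))) hL.le).trans_eq ?_)
  ring

theorem bddAbove_abs_rlInt_sub {T a : ℝ} {v : ℝ → ℝ} (ha : 0 < a)
    (hv : ContinuousOn v (Icc 0 T)) :
    BddAbove (range fun τ : Icc (0 : ℝ) T => |rlInt 0 a v τ - v τ|) := by
  obtain ⟨V, hV⟩ := isCompact_Icc.exists_bound_of_continuousOn hv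
  refine ⟨V * (T ^ a / Real.Gamma (a + 1)) + V, ?_⟩
  rintro _ ⟨⟨τ, hτ⟩, rfl⟩
  have hV0 : 0 ≤ V := (norm_nonneg _).trans (hV τ hτ)
  have hvτ := hv.mono (Icc_subset_Icc_right hτ.2)
  refine (abs_sub _ _).trans (add_le_add ?_ (hV τ hτ))
  have h1 : RLIntegrable a (fun _ => 1) τ := continuousOn_const.rlIntegrable ha hτ.1
  refine (abs_rlInt_le _ ha hτ.1).trans ((rlInt_mono ha hτ.1 (hvτ.abs.rlIntegrable ha hτ.1)
    (h1.const_mul V) fun σ hσ => ?_).trans ?_)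
  · simpa using hV σ ⟨hσ.1, hσ.2.trans hτ.2⟩
  · rw [rlInt_const_mul, rlInt_one ha hτ.1]
    exact mul_le_mul_of_nonneg_left (div_le_div_of_nonneg_right
      (Real.rpow_le_rpow hτ.1 hτ.2 ha.le) (Real.Gamma_pos_of_pos (by linarith)).le) hV0

end RiemannLiouville

theorem stmt10 (T α₂ ε s y₀ L : ℝ) (f : ℝ → ℝ → ℝ → ℝ)
    (yh w z yt zt : ℝ → ℝ)
    (hT : 0 < T) (hα₂ : 1 < α₂) (hα₂' : α₂ < 2) (hε : 0 < ε) (hε1 : ε < 1) (hL : 0 < L)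
    (hfc : Continuous fun p : ℝ × ℝ × ℝ => f p.1 p.2.1 p.2.2)
    (hlip : ∀ t ∈ Set.Icc (0:ℝ) T, ∀ x₁ x₂ y₁ y₂ : ℝ,
      |f t x₁ y₁ - f t x₂ y₂| ≤ L * (|x₁ - x₂| + |y₁ - y₂|))
    (hyh : ContinuousOn yh (Set.Icc 0 T)) (hw : ContinuousOn w (Set.Icc 0 T))
    (hz : ContinuousOn z (Set.Icc 0 T)) (hyt : ContinuousOn yt (Set.Icc 0 T))
    (hzt : ContinuousOn zt (Set.Icc 0 T))
    (heq1 : ∀ t ∈ Set.Icc (0:ℝ) T, yh t = y₀ + rlInt 0 (1 - ε) w t)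
    (heq2 : ∀ t ∈ Set.Icc (0:ℝ) T, w t = rlInt 0 ε z t)
    (heq3 : ∀ t ∈ Set.Icc (0:ℝ) T,
      z t = s + rlInt 0 (α₂ - 1) (fun τ => f τ (yh τ) (w τ)) t)
    (heq4 : ∀ t ∈ Set.Icc (0:ℝ) T, yt t = y₀ + rlInt 0 (1 - ε) zt t)
    (heq5 : ∀ t ∈ Set.Icc (0:ℝ) T,
      zt t = s + rlInt 0 (α₂ - 1) (fun τ => f τ (yt τ) (zt τ)) t) :
    ∀ t ∈ Set.Icc (0:ℝ) T,
      |z t - zt t| ≤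
        L * (T ^ (α₂ - ε) / Real.Gamma (α₂ - ε + 1) + T ^ (α₂ - 1) / Real.Gamma α₂) *
          (⨆ τ : Set.Icc (0:ℝ) T, |rlInt 0 ε zt τ - zt τ|) *
          mittagLeffler (α₂ - 1)
            (L * (Real.Gamma (α₂ - 1) / Real.Gamma (α₂ - 1 + ε) * T ^ ε
                + Real.Gamma (α₂ - 1) / Real.Gamma α₂ * T) * T ^ (α₂ - 1)) := by
  have hβ : 0 < α₂ - 1 := sub_pos.2 hα₂
  have hbdd := bddAbove_abs_rlInt_sub hε hzt
  have hM : 0 ≤ ⨆ τ : Set.Icc (0:ℝ) T, |rlInt 0 ε zt τ - zt τ| :=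
    Real.iSup_nonneg fun _ => abs_nonneg _
  have h := abs_sub_le_add_rlInt hβ hε hε1 hL hM hfc hlip hyh hw hz hyt hzt heq1 heq2 heq3 heq4 heq5
    fun t ht => le_ciSup hbdd ⟨t, ht⟩
  rw [show α₂ - 1 + (1 - ε) = α₂ - ε by ring, sub_add_cancel] at h
  have hG : ∀ {x : ℝ}, 0 < x → 0 < Real.Gamma x := Real.Gamma_pos_of_pos
  have h1 := hG hβ
  have h2 := hG (by linarith : 0 < α₂)
  have h3 := hG (by linarith : 0 < α₂ - ε + 1)
  have h4 := hG (by linarith : 0 < α₂ - 1 + ε)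
  exact le_mul_mittagLeffler_of_le_add_rlInt hβ (by linarith)
    (mul_nonneg (by positivity) hM) (by positivity) (hz.sub hzt).abs h
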